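/- Fix ρ_c > 0 and ε ∈ ℝ. Define f(v) = B_APS(v)·Ã_APS(v) with B_APS(v) = (27/8)·|v|·| |v+1|^{1/3} − |v−1|^{1/3} |³ and Ã_APS(v) = |v|·| |v+1| − |v−1| |, and set a(n) = f(ε+4n+2) for n ∈ ℤ. Let ρ̂₁ be the bounded operator on ℓ²(ℤ,ℂ) given by (ρ̂₁ψ)(n) = (ρ_c/8)·[(a(n−1)+a(n))ψ(n) − a(n−1)ψ(n−1) − a(n)ψ(n+1)], and let ρ̂ be given by (ρ̂ψ)(n) = (ρ_c/4)·(2ψ(n) − ψ(n+1) − ψ(n−1)). Then ρ̂₁ − ρ̂ is a compact operator. -/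

import Mathlib

/-- `f(v) = B_APS(v)·Ã_APS(v)
  = (27/8)·|v|·| |v+1|^(1/3) − |v−1|^(1/3) |³ · |v|·| |v+1| − |v−1| |`. -/
noncomputable def fAPS (v : ℝ) : ℝ :=
  (27 / 8) * |v| * (abs (|v + 1| ^ ((1 : ℝ) / 3) - |v - 1| ^ ((1 : ℝ) / 3))) ^ (3 : ℕ)
    * (|v| * abs (|v + 1| - |v - 1|))

/-- The lattice coefficients `a(n) = f(ε+4n+2)`. -/
noncomputable def aAPS (ε : ℝ) (n : ℤ) : ℝ := fAPS (ε + 4 * n + 2)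

open Filter Topology

theorem fAPS_neg (v : ℝ) : fAPS (-v) = fAPS v := by
  have h₁ : |-v + 1| = |v - 1| := by rw [← abs_neg]; ring_nf
  have h₂ : |-v - 1| = |v + 1| := by rw [← abs_neg]; ring_nf
  unfold fAPS
  rw [h₁, h₂, abs_neg, abs_sub_comm (|v - 1| ^ _), abs_sub_comm |v - 1|]

theorem fAPS_bounds {v : ℝ} (hv : 1 < v) :
    2 * (v / (v + 1)) ^ 2 ≤ fAPS v ∧ fAPS v ≤ 2 * (v / (v - 1)) ^ 2 := by
  have cube : ∀ w : ℝ, 0 ≤ w → (w ^ ((1 : ℝ) / 3)) ^ 3 = w := fun w hw => by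
    rw [← Real.rpow_natCast, ← Real.rpow_mul hw]; norm_num
  have hx3 := cube (v + 1) (by linarith)
  have hy3 := cube (v - 1) (by linarith)
  have hy0 : 0 < (v - 1) ^ ((1 : ℝ) / 3) := Real.rpow_pos_of_pos (by linarith) _
  have hyx : (v - 1) ^ ((1 : ℝ) / 3) < (v + 1) ^ ((1 : ℝ) / 3) :=
    Real.rpow_lt_rpow (by linarith) (by linarith) (by norm_num)
  have hf : fAPS v = 27 / 4 * v ^ 2 *
      ((v + 1) ^ ((1 : ℝ) / 3) - (v - 1) ^ ((1 : ℝ) / 3)) ^ 3 := by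
    unfold fAPS
    rw [abs_of_pos (by linarith : 0 < v + 1), abs_of_pos (by linarith : 0 < v - 1),
      abs_of_pos (by linarith : 0 < v), abs_of_pos (sub_pos.2 hyx),
      abs_of_pos (by linarith : 0 < v + 1 - (v - 1))]
    ring
  rw [hf]
  generalize (v + 1) ^ ((1 : ℝ) / 3) = x at *
  generalize (v - 1) ^ ((1 : ℝ) / 3) = y at *
  have hd : 0 < x - y := sub_pos.2 hyx
  have hprod : (x - y) * (x ^ 2 + x * y + y ^ 2) = 2 := by linear_combination hx3 - hy3
  have hlow : (x - y) * (3 * y ^ 2) ≤ 2 := by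
    rw [← hprod]; exact mul_le_mul_of_nonneg_left (by nlinarith) hd.le
  have hupp : 2 ≤ (x - y) * (3 * x ^ 2) := by
    rw [← hprod]; exact mul_le_mul_of_nonneg_left (by nlinarith) hd.le
  have hlow3 := pow_le_pow_left₀ (by positivity) hlow 3
  have hupp3 := pow_le_pow_left₀ (by norm_num) hupp 3
  have hy6 : ((x - y) * (3 * y ^ 2)) ^ 3 = 27 * (x - y) ^ 3 * (v - 1) ^ 2 := by
    rw [← hy3]; ring
  have hx6 : ((x - y) * (3 * x ^ 2)) ^ 3 = 27 * (x - y) ^ 3 * (v + 1) ^ 2 := by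
    rw [← hx3]; ring
  rw [hy6] at hlow3
  rw [hx6] at hupp3
  constructor
  · rw [div_pow, mul_div_assoc', div_le_iff₀ (by positivity)]
    nlinarith [mul_le_mul_of_nonneg_left hupp3 (sq_nonneg v)]
  · rw [div_pow, mul_div_assoc', le_div_iff₀ (pow_pos (by linarith) 2)]
    nlinarith [mul_le_mul_of_nonneg_left hlow3 (sq_nonneg v)]

theorem tendsto_div_add_const_atTop (c : ℝ) :
    Tendsto (fun v : ℝ => v / (v + c)) atTop (𝓝 1) := by
  have h : Tendsto (fun v : ℝ => 1 - c / (v + c)) atTop (𝓝 (1 - 0)) :=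
    tendsto_const_nhds.sub ((tendsto_atTop_add_const_right _ c tendsto_id).const_div_atTop c)
  rw [sub_zero] at h
  refine h.congr' ?_
  filter_upwards [eventually_gt_atTop (-c)] with v hv
  have : v + c ≠ 0 := by linarith
  field_simp
  ring

theorem tendsto_fAPS_atTop : Tendsto fAPS atTop (𝓝 2) := by
  have h (c : ℝ) : Tendsto (fun v : ℝ => 2 * (v / (v + c)) ^ 2) atTop (𝓝 2) := by
    simpa using ((tendsto_div_add_const_atTop c).pow 2).const_mul 2
  refine tendsto_of_tendsto_of_tendsto_of_le_of_le' (h 1) (h (-1)) ?_ ?_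
  · filter_upwards [eventually_gt_atTop 1] with v hv using (fAPS_bounds hv).1
  · filter_upwards [eventually_gt_atTop 1] with v hv using (fAPS_bounds hv).2

theorem tendsto_fAPS_atBot : Tendsto fAPS atBot (𝓝 2) :=
  (tendsto_fAPS_atTop.comp tendsto_neg_atBot_atTop).congr fAPS_neg

theorem tendsto_aAPS_cofinite (ε : ℝ) : Tendsto (aAPS ε) cofinite (𝓝 2) := by
  rw [Int.cofinite_eq, tendsto_sup]
  constructor
  · refine tendsto_fAPS_atBot.comp (tendsto_atBot_add_const_right _ _
      (tendsto_atBot_add_const_left _ _ ?_))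
    exact (tendsto_intCast_atBot_iff.2 tendsto_id).const_mul_atBot (by norm_num)
  · refine tendsto_fAPS_atTop.comp (tendsto_atTop_add_const_right _ _
      (tendsto_atTop_add_const_left _ _ ?_))
    exact tendsto_intCast_atTop_atTop.const_mul_atTop (by norm_num)

/-- An operator into `ℓ²` whose tails are uniformly small on bounded sets is compact. -/
theorem isCompactOperator_of_tail_le {ι E : Type*} [NormedAddCommGroup E] [NormedSpace ℂ E]
    (T : E →L[ℂ] lp (fun _ : ι => ℂ) 2)
    (hT : ∀ δ > 0, ∃ s : Finset ι, ∀ ψ : E, ∀ t : Finset ι, Disjoint t s →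
      ∑ n ∈ t, ‖T ψ n‖ ^ 2 ≤ (δ * ‖ψ‖) ^ 2) :
    IsCompactOperator T := by
  classical
  let P (s : Finset ι) : E →L[ℂ] lp (fun _ : ι => ℂ) 2 :=
    ∑ n ∈ s, lp.singleContinuousLinearMap ℂ (fun _ : ι => ℂ) 2 n ∘L
      lp.evalCLM ℂ (fun _ : ι => ℂ) 2 n ∘L T
  have hP (s : Finset ι) : P s ∈ compactOperator (RingHom.id ℂ) E (lp (fun _ : ι => ℂ) 2) := by
    refine Submodule.sum_mem _ fun n _ => ?_
    exact ((isCompactOperator_id (E := ℂ)).comp_clm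
      (lp.evalCLM ℂ (fun _ : ι => ℂ) 2 n ∘L T)).clm_comp (lp.singleContinuousLinearMap ℂ (fun _ : ι => ℂ) 2 n)
  have hPapply (s : Finset ι) (ψ : E) (n : ι) : P s ψ n = if n ∈ s then T ψ n else 0 := by
    simp only [P, sum_apply, lp.coeFn_sum]
    refine (Finset.sum_apply n s _).trans ?_
    exact Finset.sum_pi_single n (fun i => T ψ i) s
  have hmem : T ∈ closure {S : E →L[ℂ] lp (fun _ : ι => ℂ) 2 | IsCompactOperator S} := by
    refine Metric.mem_closure_iff.2 fun δ hδ => ?_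
    obtain ⟨s, hs⟩ := hT (δ / 2) (half_pos hδ)
    refine ⟨P s, hP s, ?_⟩
    rw [dist_eq_norm]
    refine (ContinuousLinearMap.opNorm_le_bound _ (half_pos hδ).le fun ψ => ?_).trans_lt
      (half_lt_self hδ)
    refine lp.norm_le_of_forall_sum_le (by norm_num) (by positivity) fun t => ?_
    have h := hs ψ (t \ s) Finset.sdiff_disjoint
    simp only [ENNReal.toReal_ofNat, Real.rpow_ofNat]
    refine le_trans (le_of_eq ?_) h
    rw [← Finset.sum_subset (Finset.sdiff_subset : t \ s ⊆ t)]
    · refine Finset.sum_congr rfl fun n hn => ?_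
      simp [hPapply, (Finset.mem_sdiff.1 hn).2]
    · intro n hn hn'
      have : n ∈ s := by simpa [hn] using hn'
      simp [hPapply, this]
  rwa [isClosed_setOfPred_isCompactOperator.closure_eq] at hmem

theorem sum_norm_sq_comp_le {ι : Type*} (ψ : lp (fun _ : ι => ℂ) 2) (e : ι ↪ ι) (t : Finset ι) :
    ∑ n ∈ t, ‖ψ (e n)‖ ^ 2 ≤ ‖ψ‖ ^ 2 := by
  have h := lp.sum_rpow_le_norm_rpow (p := 2) (by norm_num) ψ (t.map e)
  simpa [Finset.sum_map] using h

/-- A second-order difference operator whose coefficients vanish at infinity is compact. -/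
theorem isCompactOperator_of_tendsto_coeff {b : ℤ → ℝ} (hb : Tendsto b cofinite (𝓝 0)) (c : ℂ)
    (T : lp (fun _ : ℤ => ℂ) 2 →L[ℂ] lp (fun _ : ℤ => ℂ) 2)
    (hT : ∀ ψ : lp (fun _ : ℤ => ℂ) 2, ∀ n : ℤ,
      T ψ n = c * ((b (n - 1) + b n) * ψ n - b (n - 1) * ψ (n - 1) - b n * ψ (n + 1))) :
    IsCompactOperator T := by
  refine isCompactOperator_of_tail_le T fun δ hδ => ?_
  set η : ℝ := δ / (4 * (‖c‖ + 1)) with hη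
  have hη0 : 0 < η := by positivity
  have hcη : 4 * ‖c‖ * η ≤ δ := by
    rw [hη, mul_div_assoc', div_le_iff₀ (by positivity)]
    nlinarith [norm_nonneg c]
  have hsmall : ∀ᶠ n in cofinite, ‖b n‖ ≤ η := by
    filter_upwards [hb.norm.eventually_le_const (by simpa using hη0)] with n hn using hn
  have hsmall' : ∀ᶠ n in cofinite, ‖b (n - 1)‖ ≤ η :=
    (sub_left_injective (b := (1 : ℤ))).tendsto_cofinite.eventually hsmall
  have hfin := eventually_cofinite.1 (hsmall.and hsmall')
  refine ⟨hfin.toFinset, fun ψ t ht => ?_⟩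
  have key : ∀ n ∈ t, ‖T ψ n‖ ^ 2 ≤
      (‖c‖ * η) ^ 2 * 4 * (2 * ‖ψ n‖ ^ 2 + ‖ψ (n - 1)‖ ^ 2 + ‖ψ (n + 1)‖ ^ 2) := by
    intro n hn
    obtain ⟨h₀, h₁⟩ : ‖b n‖ ≤ η ∧ ‖b (n - 1)‖ ≤ η := by
      simpa using Finset.disjoint_left.1 ht hn
    have hle : ‖T ψ n‖ ≤ ‖c‖ * η * (2 * ‖ψ n‖ + ‖ψ (n - 1)‖ + ‖ψ (n + 1)‖) := by
      rw [hT, norm_mul, mul_assoc]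
      refine mul_le_mul_of_nonneg_left ?_ (norm_nonneg c)
      calc _ ≤ ‖((b (n - 1) : ℂ) + b n) * ψ n‖ + ‖(b (n - 1) : ℂ) * ψ (n - 1)‖
            + ‖(b n : ℂ) * ψ (n + 1)‖ :=
            (norm_sub_le _ _).trans (add_le_add_left (norm_sub_le _ _) _)
        _ ≤ (η + η) * ‖ψ n‖ + η * ‖ψ (n - 1)‖ + η * ‖ψ (n + 1)‖ := by
            simp only [norm_mul, Complex.norm_real]
            gcongr
            refine (norm_add_le _ _).trans ?_
            simp only [Complex.norm_real]
            gcongr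
        _ = _ := by ring
    refine (pow_le_pow_left₀ (norm_nonneg _) hle 2).trans ?_
    rw [mul_pow, mul_assoc]
    refine mul_le_mul_of_nonneg_left ?_ (sq_nonneg _)
    nlinarith [sq_nonneg (‖ψ n‖ - ‖ψ (n - 1)‖), sq_nonneg (‖ψ n‖ - ‖ψ (n + 1)‖),
      sq_nonneg (‖ψ (n - 1)‖ - ‖ψ (n + 1)‖)]
  have s₀ := sum_norm_sq_comp_le ψ (Function.Embedding.refl ℤ) t
  have s₁ := sum_norm_sq_comp_le ψ (Equiv.subRight (1 : ℤ)).toEmbedding t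
  have s₂ := sum_norm_sq_comp_le ψ (Equiv.addRight (1 : ℤ)).toEmbedding t
  simp only [Function.Embedding.refl_apply, Equiv.coe_toEmbedding, Equiv.subRight_apply,
    Equiv.coe_addRight] at s₀ s₁ s₂
  calc ∑ n ∈ t, ‖T ψ n‖ ^ 2
      ≤ ∑ n ∈ t, (‖c‖ * η) ^ 2 * 4 * (2 * ‖ψ n‖ ^ 2 + ‖ψ (n - 1)‖ ^ 2 + ‖ψ (n + 1)‖ ^ 2) :=
        Finset.sum_le_sum key
    _ = (‖c‖ * η) ^ 2 * 4 * (2 * ∑ n ∈ t, ‖ψ n‖ ^ 2 + ∑ n ∈ t, ‖ψ (n - 1)‖ ^ 2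
          + ∑ n ∈ t, ‖ψ (n + 1)‖ ^ 2) := by
        rw [← Finset.mul_sum, Finset.sum_add_distrib, Finset.sum_add_distrib, ← Finset.mul_sum]
    _ ≤ (‖c‖ * η) ^ 2 * 4 * (4 * ‖ψ‖ ^ 2) :=
        mul_le_mul_of_nonneg_left (by linarith) (by positivity)
    _ = (4 * ‖c‖ * η * ‖ψ‖) ^ 2 := by ring
    _ ≤ (δ * ‖ψ‖) ^ 2 := by gcongr


/-- The APS energy density operator `ρ̂₁` differs from its sLQC counterpart `ρ̂`
by a compact operator. -/
theorem stmt9 (ρc : ℝ) (hρc : 0 < ρc) (ε : ℝ)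
    (ρ₁ ρ : lp (fun _ : ℤ => ℂ) 2 →L[ℂ] lp (fun _ : ℤ => ℂ) 2)
    (hρ₁ : ∀ ψ : lp (fun _ : ℤ => ℂ) 2, ∀ n : ℤ,
      ρ₁ ψ n = (ρc / 8 : ℂ) * (((aAPS ε (n - 1) : ℝ) + aAPS ε n : ℝ) * ψ n
        - (aAPS ε (n - 1) : ℂ) * ψ (n - 1) - (aAPS ε n : ℂ) * ψ (n + 1)))
    (hρ : ∀ ψ : lp (fun _ : ℤ => ℂ) 2, ∀ n : ℤ,
      ρ ψ n = (ρc / 4 : ℂ) * (2 * ψ n - ψ (n + 1) - ψ (n - 1))) :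
    IsCompactOperator (ρ₁ - ρ) := by
  have hb : Tendsto (fun n => aAPS ε n - 2) cofinite (𝓝 0) := by
    simpa using (tendsto_aAPS_cofinite ε).sub_const 2
  refine isCompactOperator_of_tendsto_coeff hb (ρc / 8 : ℂ) (ρ₁ - ρ) fun ψ n => ?_
  have h : (ρ₁ - ρ) ψ n = ρ₁ ψ n - ρ ψ n := rfl
  rw [h, hρ₁, hρ]
  push_cast
  ring
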